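/- Let a = (a_1,…,a_d) and b = (b_1,…,b_d) be d-tuples of permutations of {1,…,n} such that the subgroups of S_n generated by {a_1,…,a_d} and by {b_1,…,b_d} are both transitive, and fix a vertex v ∈ {1,…,n}. Then there exists τ ∈ S_n with b_j = τ⁻¹ a_j τ for all j if and only if there exists a vertex u ∈ {1,…,n} such that for all finite words w, w' over {1,…,d}: v^{a_w} = v^{a_{w'}} if and only if u^{b_w} = u^{b_{w'}}. -/

import Mathlib

/-- `τ` simultaneously conjugates the tuple `a` to the tuple `b`:
with the paper's left-to-right composition, `b_j = τ⁻¹ a_j τ` means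
`i^{b_j} = τ(a_j(τ⁻¹(i)))` for every `i`. -/
def SimConj {n d : ℕ} (τ : Equiv.Perm (Fin n)) (a b : Fin d → Equiv.Perm (Fin n)) : Prop :=
  ∀ j : Fin d, ∀ i : Fin n, b j i = τ (a j (τ⁻¹ i))

/-- The product `a_{w_1} a_{w_2} ⋯ a_{w_m}` associated with a word `w` over the colours,
composed left to right (the first letter acts first; the empty word gives the identity). -/
def wordProd {n d : ℕ} (a : Fin d → Equiv.Perm (Fin n)) (w : List (Fin d)) :
    Equiv.Perm (Fin n) :=
  ((w.map a).reverse).prod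

theorem wordProd_concat {n d : ℕ} (a : Fin d → Equiv.Perm (Fin n)) (w : List (Fin d))
    (j : Fin d) : wordProd a (w ++ [j]) = a j * wordProd a w := by
  simp [wordProd]

theorem exists_wordProd_eq_of_mem_closure {n d : ℕ} {a : Fin d → Equiv.Perm (Fin n)}
    {h : Equiv.Perm (Fin n)} (hh : h ∈ Subgroup.closure (Set.range a)) :
    ∃ w : List (Fin d), wordProd a w = h := by
  rw [← Subgroup.mem_toSubmonoid, Subgroup.closure_toSubmonoid_of_finite] at hh
  induction hh using Submonoid.closure_induction_left with
  | one => exact ⟨[], by simp [wordProd]⟩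
  | mul_left x hx y _ ih =>
    obtain ⟨j, rfl⟩ := hx
    obtain ⟨w, rfl⟩ := ih
    exact ⟨w ++ [j], wordProd_concat a w j⟩

theorem SimConj.wordProd_apply {n d : ℕ} {τ : Equiv.Perm (Fin n)}
    {a b : Fin d → Equiv.Perm (Fin n)} (h : SimConj τ a b) (w : List (Fin d)) (i : Fin n) :
    wordProd b w (τ i) = τ (wordProd a w i) := by
  induction w using List.reverseRecOn with
  | nil => simp [wordProd]
  | append_singleton w j ih => simp [wordProd_concat, ih, h j]

theorem exists_wordProd_apply_eq {n d : ℕ} {a : Fin d → Equiv.Perm (Fin n)}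
    (ha : ∀ u v : Fin n, ∃ h ∈ Subgroup.closure (Set.range a), h u = v) (u v : Fin n) :
    ∃ w : List (Fin d), wordProd a w u = v := by
  obtain ⟨h, hh, rfl⟩ := ha u v
  obtain ⟨w, rfl⟩ := exists_wordProd_eq_of_mem_closure hh
  exact ⟨w, rfl⟩

/-- For tuples `a`, `b` generating transitive subgroups and a fixed vertex `v`,
`a` and `b` are simultaneously conjugate iff there is a vertex `u` such that for all words
`w, w'`: `v^{a_w} = v^{a_{w'}}` iff `u^{b_w} = u^{b_{w'}}` — i.e. the two connected
permutation digraphs have the same pattern of coincidences among walks from suitable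
base vertices. -/
theorem simConj_iff_word_coincidences {n d : ℕ}
    (a b : Fin d → Equiv.Perm (Fin n))
    (ha : ∀ u v : Fin n, ∃ h ∈ Subgroup.closure (Set.range a), h u = v)
    (hb : ∀ u v : Fin n, ∃ h ∈ Subgroup.closure (Set.range b), h u = v)
    (v : Fin n) :
    (∃ τ : Equiv.Perm (Fin n), SimConj τ a b) ↔
      (∃ u : Fin n, ∀ w w' : List (Fin d),
        wordProd a w v = wordProd a w' v ↔ wordProd b w u = wordProd b w' u) := by
  constructor
  · rintro ⟨τ, hτ⟩
    exact ⟨τ v, fun w w' => by simp [hτ.wordProd_apply]⟩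
  · rintro ⟨u, hu⟩
    choose f hf using exists_wordProd_apply_eq ha v
    have hf_apply (w : List (Fin d)) :
        wordProd b (f (wordProd a w v)) u = wordProd b w u := (hu _ _).1 (hf _)
    have hinj : Function.Injective fun x => wordProd b (f x) u := fun x y hxy => by
      rw [← hf x, ← hf y]
      exact (hu _ _).2 hxy
    let τ := Equiv.ofBijective _ (Finite.injective_iff_bijective.1 hinj)
    refine ⟨τ, fun j i => ?_⟩
    obtain ⟨x, rfl⟩ := τ.surjective i
    have key := hf_apply (f x ++ [j])
    rw [wordProd_concat, wordProd_concat, Equiv.Perm.mul_apply, Equiv.Perm.mul_apply, hf] at key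
    rw [show τ⁻¹ (τ x) = x from τ.symm_apply_apply x]
    exact key.symm
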